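/- arXiv:1912.07896 — 2 statements merged into one kernel-verified Lean document; each statement's English description precedes it below -/
import Mathlib

section
/- (Eckart–Young–Mirsky, spectral norm) Let X ∈ ℝ^{n×m} with n ≥ m have singular value decomposition X = Σ_{i=1}^{m} σ_i u_i v_iᵀ with σ_1 ≥ σ_2 ≥ … ≥ σ_m ≥ 0, where u_i and v_i are the orthonormal columns of the orthogonal factors U and V. Fix k < m and set X_k = Σ_{i=1}^{k} σ_i u_i v_iᵀ. Then ‖X − X_k‖₂ = σ_{k+1}, and for every matrix B ∈ ℝ^{n×m} with rank(B) ≤ k one has ‖X − B‖₂ ≥ σ_{k+1}; that is, the truncated SVD X_k is a best rank-k approximation of X in the spectral norm. -/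
open Matrix

/-- The Euclidean norm `‖v‖₂` of a vector. -/
noncomputable def euclNorm {n : ℕ} (v : Fin n → ℝ) : ℝ :=
  Real.sqrt (∑ i, (v i) ^ 2)

/-- The spectral norm `‖A‖₂ = sup_{w ≠ 0} ‖Aw‖₂ / ‖w‖₂` of a matrix. -/
noncomputable def specNorm {n m : ℕ} (A : Matrix (Fin n) (Fin m) ℝ) : ℝ :=
  sSup {c : ℝ | ∃ w : Fin m → ℝ, w ≠ 0 ∧ c = euclNorm (A.mulVec w) / euclNorm w}

theorem euclNorm_eq_norm_toLp {n : ℕ} (v : Fin n → ℝ) : euclNorm v = ‖WithLp.toLp 2 v‖ := by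
  simp [euclNorm, EuclideanSpace.norm_eq]

theorem euclNorm_pos {n : ℕ} {v : Fin n → ℝ} (hv : v ≠ 0) : 0 < euclNorm v := by
  rw [euclNorm_eq_norm_toLp, norm_pos_iff]
  simpa using hv

theorem euclNorm_sq {n : ℕ} (v : Fin n → ℝ) : euclNorm v ^ 2 = v ⬝ᵥ v := by
  rw [euclNorm, Real.sq_sqrt (Finset.sum_nonneg fun i _ => sq_nonneg _)]
  simp [dotProduct, sq]

theorem euclNorm_mulVec_of_transpose_mul_self {n m : ℕ} {Q : Matrix (Fin n) (Fin m) ℝ}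
    (hQ : Qᵀ * Q = 1) (x : Fin m → ℝ) : euclNorm (Q *ᵥ x) = euclNorm x := by
  have h : euclNorm (Q *ᵥ x) ^ 2 = euclNorm x ^ 2 := by
    rw [euclNorm_sq, euclNorm_sq, dotProduct_mulVec, ← mulVec_transpose, mulVec_mulVec, hQ,
      one_mulVec]
  exact (sq_eq_sq₀ (Real.sqrt_nonneg _) (Real.sqrt_nonneg _)).1 h

theorem euclNorm_le_euclNorm {n : ℕ} {x y : Fin n → ℝ} (h : ∀ i, x i ^ 2 ≤ y i ^ 2) :
    euclNorm x ≤ euclNorm y :=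
  Real.sqrt_le_sqrt (Finset.sum_le_sum fun i _ => h i)

theorem euclNorm_smul {n : ℕ} {c : ℝ} (hc : 0 ≤ c) (x : Fin n → ℝ) :
    euclNorm (c • x) = c * euclNorm x := by
  rw [euclNorm_eq_norm_toLp, euclNorm_eq_norm_toLp, WithLp.toLp_smul, norm_smul,
    Real.norm_of_nonneg hc]

open scoped Matrix.Norms.L2Operator in
theorem le_specNorm {n m : ℕ} (A : Matrix (Fin n) (Fin m) ℝ) {c : ℝ} {w : Fin m → ℝ}
    (hw : w ≠ 0) (h : c * euclNorm w ≤ euclNorm (A *ᵥ w)) : c ≤ specNorm A := by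
  refine ((le_div_iff₀ (euclNorm_pos hw)).2 h).trans (le_csSup ⟨‖A‖, ?_⟩ ⟨w, hw, rfl⟩)
  rintro _ ⟨x, hx, rfl⟩
  rw [div_le_iff₀ (euclNorm_pos hx), euclNorm_eq_norm_toLp, euclNorm_eq_norm_toLp]
  exact l2_opNorm_mulVec A (WithLp.toLp 2 x)

theorem specNorm_le {n m : ℕ} (A : Matrix (Fin n) (Fin m) ℝ) {c : ℝ} (hc : 0 ≤ c)
    (h : ∀ w, euclNorm (A *ᵥ w) ≤ c * euclNorm w) : specNorm A ≤ c := by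
  refine Real.sSup_le ?_ hc
  rintro _ ⟨w, hw, rfl⟩
  exact (div_le_iff₀ (euclNorm_pos hw)).2 (h w)

theorem transpose_mul_self_submatrix {n m l : ℕ} {Q : Matrix (Fin n) (Fin m) ℝ}
    (hQ : Qᵀ * Q = 1) {f : Fin l → Fin m} (hf : Function.Injective f) :
    (Q.submatrix id f)ᵀ * Q.submatrix id f = 1 := by
  rw [transpose_submatrix, ← submatrix_mul Qᵀ Q f id f Function.bijective_id, hQ,
    submatrix_one f hf]

theorem euclNorm_sum_vecMulVec_mulVec {n m : ℕ} (hnm : m ≤ n) {U : Matrix (Fin n) (Fin n) ℝ}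
    (hU : Uᵀ * U = 1) (V : Matrix (Fin m) (Fin m) ℝ) (τ : Fin m → ℝ) (w : Fin m → ℝ) :
    euclNorm ((∑ i : Fin m,
      τ i • vecMulVec (fun a => U a (Fin.castLE hnm i)) (fun b => V b i)) *ᵥ w) =
      euclNorm (fun i => τ i * (Vᵀ *ᵥ w) i) := by
  rw [← euclNorm_mulVec_of_transpose_mul_self
    (transpose_mul_self_submatrix hU (Fin.castLE_injective hnm))]
  congr 1
  rw [sum_mulVec]
  ext a
  simp only [Finset.sum_apply, smul_mulVec, vecMulVec_mulVec, Pi.smul_apply, smul_eq_mul,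
    mulVec, dotProduct, submatrix_apply, id_eq, transpose_apply, MulOpposite.smul_eq_mul_unop,
    MulOpposite.unop_op]
  exact Finset.sum_congr rfl fun i _ => by ring

/-- A matrix with rank less than its number of columns has a nontrivial kernel. -/
theorem exists_ne_zero_mulVec_eq_zero_of_rank_lt {n l : ℕ} (A : Matrix (Fin n) (Fin l) ℝ)
    (hA : A.rank < l) : ∃ z, z ≠ 0 ∧ A *ᵥ z = 0 := by
  by_contra! h
  have hinj : Function.Injective A.mulVecLin := by
    rw [← LinearMap.ker_eq_bot, LinearMap.ker_eq_bot']
    intro z hz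
    by_contra hz0
    exact h z hz0 hz
  have := LinearMap.finrank_range_of_inj hinj
  rw [Module.finrank_fin_fun] at this
  exact hA.ne this

/-- Eckart–Young–Mirsky theorem in the spectral norm: the truncated SVD `X_k` satisfies
`‖X − X_k‖₂ = σ_{k+1}` and is a best rank-`k` approximation of `X`. -/
theorem eckart_young_mirsky_spectral {n m : ℕ} (hnm : m ≤ n)
    (X : Matrix (Fin n) (Fin m) ℝ)
    (U : Matrix (Fin n) (Fin n) ℝ) (V : Matrix (Fin m) (Fin m) ℝ)
    (hU : Uᵀ * U = 1) (hV : Vᵀ * V = 1)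
    (σ : Fin m → ℝ) (hσ0 : ∀ i, 0 ≤ σ i) (hσmono : ∀ i j : Fin m, i ≤ j → σ j ≤ σ i)
    (hX : X = ∑ i : Fin m,
      σ i • vecMulVec (fun a => U a (Fin.castLE hnm i)) (fun b => V b i))
    (k : ℕ) (hk : k < m)
    (Xk : Matrix (Fin n) (Fin m) ℝ)
    (hXk : Xk = ∑ i ∈ Finset.univ.filter (fun i : Fin m => (i : ℕ) < k),
      σ i • vecMulVec (fun a => U a (Fin.castLE hnm i)) (fun b => V b i)) :
    specNorm (X - Xk) = σ ⟨k, hk⟩ ∧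
      ∀ B : Matrix (Fin n) (Fin m) ℝ, B.rank ≤ k → σ ⟨k, hk⟩ ≤ specNorm (X - B) := by
  have hV' : Vᵀᵀ * Vᵀ = 1 := by rw [transpose_transpose]; exact mul_eq_one_comm.1 hV
  constructor
  · have hsub : X - Xk = ∑ i : Fin m, (if (i : ℕ) < k then 0 else σ i) •
        vecMulVec (fun a => U a (Fin.castLE hnm i)) (fun b => V b i) := by
      rw [hX, hXk, Finset.sum_filter, ← Finset.sum_sub_distrib]
      exact Finset.sum_congr rfl fun i _ => by split_ifs <;> simp
    apply le_antisymm
    · refine specNorm_le _ (hσ0 _) fun w => ?_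
      rw [hsub, euclNorm_sum_vecMulVec_mulVec hnm hU,
        ← euclNorm_mulVec_of_transpose_mul_self hV' w, ← euclNorm_smul (hσ0 _)]
      refine euclNorm_le_euclNorm fun i => ?_
      rw [Pi.smul_apply, smul_eq_mul, mul_pow, mul_pow]
      refine mul_le_mul_of_nonneg_right ?_ (sq_nonneg _)
      split_ifs with hi
      · simpa using sq_nonneg _
      · exact pow_le_pow_left₀ (hσ0 i) (hσmono _ _ (Fin.mk_le_of_le_val (not_lt.1 hi))) 2
    · have hVw : Vᵀ *ᵥ (V *ᵥ Pi.single ⟨k, hk⟩ 1) = Pi.single ⟨k, hk⟩ 1 := by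
        rw [mulVec_mulVec, hV, one_mulVec]
      refine le_specNorm _ (w := V *ᵥ Pi.single ⟨k, hk⟩ 1) (fun h => ?_) ?_
      · rw [h, mulVec_zero] at hVw
        simpa using congrFun hVw ⟨k, hk⟩
      · rw [hsub, euclNorm_sum_vecMulVec_mulVec hnm hU, euclNorm_mulVec_of_transpose_mul_self hV,
          ← euclNorm_smul (hσ0 _), hVw]
        refine euclNorm_le_euclNorm fun i => ?_
        by_cases hi : i = ⟨k, hk⟩
        · subst hi; simp
        · simp [hi]
  · intro B hB
    let W := V.submatrix id (Fin.castLE (Nat.succ_le_of_lt hk))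
    have hW : Wᵀ * W = 1 := transpose_mul_self_submatrix hV (Fin.castLE_injective _)
    obtain ⟨z, hz, hBz⟩ := exists_ne_zero_mulVec_eq_zero_of_rank_lt (B * W)
      (((rank_mul_le_left B W).trans hB).trans_lt k.lt_succ_self)
    refine le_specNorm _ (w := W *ᵥ z) (fun h => hz ?_) ?_
    · rw [← one_mulVec z, ← hW, ← mulVec_mulVec, h, mulVec_zero]
    · rw [sub_mulVec, mulVec_mulVec z B W, hBz, sub_zero, hX,
        euclNorm_sum_vecMulVec_mulVec hnm hU, ← euclNorm_mulVec_of_transpose_mul_self hV' (W *ᵥ z),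
        ← euclNorm_smul (hσ0 _)]
      refine euclNorm_le_euclNorm fun i => ?_
      rw [Pi.smul_apply, smul_eq_mul, mul_pow, mul_pow]
      rcases le_or_gt i ⟨k, hk⟩ with hi | hi
      · exact mul_le_mul_of_nonneg_right (pow_le_pow_left₀ (hσ0 _) (hσmono _ _ hi) 2)
          (sq_nonneg _)
      · have hVW : Vᵀ * W = (1 : Matrix (Fin m) (Fin m) ℝ).submatrix id
            (Fin.castLE (Nat.succ_le_of_lt hk)) := by
          rw [← hV]; rfl
        have h0 : (Vᵀ *ᵥ (W *ᵥ z)) i = 0 := by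
          rw [mulVec_mulVec, hVW, mulVec, dotProduct]
          refine Finset.sum_eq_zero fun j _ => ?_
          have hij : i ≠ Fin.castLE (Nat.succ_le_of_lt hk) j := by
            rintro rfl
            exact absurd j.isLt (not_lt.2 (Nat.succ_le_of_lt hi))
          rw [submatrix_apply, id_eq, one_apply_ne hij, zero_mul]
        simp [h0]
end

section
/- (Eckart–Young–Mirsky, Frobenius norm) Let X ∈ ℝ^{n×m} with n ≥ m have singular value decomposition X = Σ_{i=1}^{m} σ_i u_i v_iᵀ with σ_1 ≥ σ_2 ≥ … ≥ σ_m ≥ 0, where u_i and v_i are the orthonormal columns of the orthogonal factors U and V. Fix k < m and set X_k = Σ_{i=1}^{k} σ_i u_i v_iᵀ. Then ‖X − X_k‖_F² = Σ_{i=k+1}^{m} σ_i², and for every matrix B ∈ ℝ^{n×m} with rank(B) ≤ k one has ‖X − B‖_F² ≥ Σ_{i=k+1}^{m} σ_i²; that is, the truncated SVD X_k is a best rank-k approximation of X in the Frobenius norm. -/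
open Matrix

/-- The squared Frobenius norm `‖A‖_F² = Σ_{i,j} A_{ij}²` of a matrix. -/
def frobNormSq {n m : ℕ} (A : Matrix (Fin n) (Fin m) ℝ) : ℝ :=
  ∑ i, ∑ j, (A i j) ^ 2

open scoped InnerProductSpace

theorem frobNormSq_eq_trace {n m : ℕ} (A : Matrix (Fin n) (Fin m) ℝ) :
    frobNormSq A = (A * Aᵀ).trace := by
  simp [frobNormSq, Matrix.trace, Matrix.mul_apply, pow_two]

theorem frobNormSq_mul_of_mul_transpose_eq_one {n m : ℕ} (A : Matrix (Fin n) (Fin m) ℝ)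
    {V : Matrix (Fin m) (Fin m) ℝ} (hV : V * Vᵀ = 1) : frobNormSq (A * V) = frobNormSq A := by
  rw [frobNormSq_eq_trace, frobNormSq_eq_trace, transpose_mul, Matrix.mul_assoc,
    ← Matrix.mul_assoc V, hV, Matrix.one_mul]

theorem frobNormSq_eq_sum_norm_col {n m : ℕ} (A : Matrix (Fin n) (Fin m) ℝ) :
    frobNormSq A = ∑ j, ‖WithLp.toLp 2 (A.col j)‖ ^ 2 := by
  simp only [frobNormSq, EuclideanSpace.norm_sq_eq, Real.norm_eq_abs, sq_abs, Matrix.col_apply]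
  exact Finset.sum_comm

theorem orthonormal_col {n : ℕ} {U : Matrix (Fin n) (Fin n) ℝ} (hU : Uᵀ * U = 1) :
    Orthonormal ℝ fun i => WithLp.toLp 2 (U.col i) := by
  rw [orthonormal_iff_ite]
  intro i j
  have h := congrFun₂ hU i j
  rw [Matrix.one_apply, Matrix.mul_apply] at h
  rw [← h, PiLp.inner_apply]
  simp [mul_comm]

theorem sum_smul_vecMulVec_mul_col {n m : ℕ} (s : Finset (Fin m)) (σ : Fin m → ℝ)
    (u : Fin m → Fin n → ℝ) {V : Matrix (Fin m) (Fin m) ℝ} (hV : Vᵀ * V = 1) (j : Fin m) :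
    ((∑ i ∈ s, σ i • vecMulVec (u i) (fun b => V b i)) * V).col j =
      if j ∈ s then σ j • u j else 0 := by
  have h (i : Fin m) : ∑ b, V b i * V b j = if i = j then 1 else 0 := by
    simpa [Matrix.mul_apply, Matrix.one_apply] using congrFun₂ hV i j
  ext a
  simp only [Matrix.col_apply, Matrix.mul_apply, Matrix.sum_apply, Matrix.smul_apply,
    vecMulVec_apply, Finset.sum_mul, smul_eq_mul]
  rw [Finset.sum_comm]
  simp only [mul_assoc, ← Finset.mul_sum, h]
  by_cases hj : j ∈ s <;> simp [hj]

/-- A weighted sum of a nonincreasing nonnegative sequence with weights in `[0, 1]` of total mass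
at most `k` is at most the sum of its first `k` terms. -/
theorem sum_mul_le_sum_filter_lt {m k : ℕ} (hk : k < m) (a p : Fin m → ℝ) (ha : ∀ i, 0 ≤ a i)
    (hmono : Antitone a) (hp0 : ∀ i, 0 ≤ p i) (hp1 : ∀ i, p i ≤ 1) (hp : ∑ i, p i ≤ k) :
    ∑ i, a i * p i ≤ ∑ i ∈ Finset.univ.filter (fun i : Fin m => (i : ℕ) < k), a i := by
  set t := a ⟨k, hk⟩
  have hcard : (Finset.univ.filter fun i : Fin m => (i : ℕ) < k).card = k := by
    rw [Fin.card_filter_val_lt, min_eq_right hk.le]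
  have h : ∑ i, (a i - t) * p i ≤ ∑ i ∈ Finset.univ.filter (fun i : Fin m => (i : ℕ) < k),
      (a i - t) := by
    rw [Finset.sum_filter]
    refine Finset.sum_le_sum fun i _ => ?_
    split_ifs with hi
    · have : t ≤ a i := hmono (Fin.le_def.2 hi.le)
      nlinarith [hp1 i]
    · have : a i ≤ t := hmono (Fin.le_def.2 (not_lt.1 hi))
      nlinarith [hp0 i]
  simp only [sub_mul, Finset.sum_sub_distrib, ← Finset.mul_sum, Finset.sum_const, hcard,
    nsmul_eq_mul] at h
  nlinarith [mul_le_mul_of_nonneg_left hp (ha ⟨k, hk⟩)]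

section Projection

variable {E : Type*} [NormedAddCommGroup E] [InnerProductSpace ℝ E]

theorem sq_mul_one_sub_le_norm_smul_sub_sq (W : Submodule ℝ E) [W.HasOrthogonalProjection]
    {u y : E} (hu : ‖u‖ = 1) (hy : y ∈ W) (c : ℝ) :
    c ^ 2 * (1 - ‖W.starProjection u‖ ^ 2) ≤ ‖c • u - y‖ ^ 2 := by
  have h : ⟪W.starProjection u, y⟫_ℝ = ⟪u, y⟫_ℝ := by
    rw [Submodule.inner_starProjection_left_eq_right, Submodule.starProjection_eq_self_iff.2 hy]
  have h0 := sq_nonneg ‖c • W.starProjection u - y‖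
  rw [norm_sub_sq_real, norm_smul, inner_smul_left, h] at h0
  rw [norm_sub_sq_real, norm_smul, inner_smul_left, hu]
  simp only [mul_pow, Real.norm_eq_abs, sq_abs, mul_one] at h0 ⊢
  linarith

theorem sum_norm_starProjection_sq_le_finrank (W : Submodule ℝ E) [FiniteDimensional ℝ W]
    {ι : Type*} [Fintype ι] {u : ι → E} (hu : Orthonormal ℝ u) :
    ∑ j, ‖W.starProjection (u j)‖ ^ 2 ≤ Module.finrank ℝ W := by
  let w := stdOrthonormalBasis ℝ W
  have h (j : ι) : ‖W.starProjection (u j)‖ ^ 2 = ∑ l, ‖⟪u j, (w l : E)⟫_ℝ‖ ^ 2 := by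
    rw [Submodule.starProjection_apply, Submodule.norm_coe, ← w.sum_sq_norm_inner_left]
    simp only [Submodule.coe_inner, ← Submodule.starProjection_apply,
      Submodule.inner_starProjection_left_eq_right, Submodule.starProjection_mem_subspace_eq_self]
  simp only [h]
  rw [Finset.sum_comm]
  calc ∑ l, ∑ j, ‖⟪u j, (w l : E)⟫_ℝ‖ ^ 2 ≤ ∑ l, ‖(w l : E)‖ ^ 2 :=
        Finset.sum_le_sum fun l _ => hu.sum_inner_products_le _
    _ = Module.finrank ℝ W := by simp [Submodule.norm_coe]

end Projection

/-- Eckart–Young–Mirsky theorem in the Frobenius norm: the truncated SVD `X_k` satisfies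
`‖X − X_k‖_F² = Σ_{i>k} σ_i²` and is a best rank-`k` approximation of `X`. -/
theorem eckart_young_mirsky_frobenius {n m : ℕ} (hnm : m ≤ n)
    (X : Matrix (Fin n) (Fin m) ℝ)
    (U : Matrix (Fin n) (Fin n) ℝ) (V : Matrix (Fin m) (Fin m) ℝ)
    (hU : Uᵀ * U = 1) (hV : Vᵀ * V = 1)
    (σ : Fin m → ℝ) (hσ0 : ∀ i, 0 ≤ σ i) (hσmono : ∀ i j : Fin m, i ≤ j → σ j ≤ σ i)
    (hX : X = ∑ i : Fin m,
      σ i • vecMulVec (fun a => U a (Fin.castLE hnm i)) (fun b => V b i))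
    (k : ℕ) (hk : k < m)
    (Xk : Matrix (Fin n) (Fin m) ℝ)
    (hXk : Xk = ∑ i ∈ Finset.univ.filter (fun i : Fin m => (i : ℕ) < k),
      σ i • vecMulVec (fun a => U a (Fin.castLE hnm i)) (fun b => V b i)) :
    frobNormSq (X - Xk) = ∑ i ∈ Finset.univ.filter (fun i : Fin m => k ≤ (i : ℕ)), (σ i) ^ 2 ∧
      ∀ B : Matrix (Fin n) (Fin m) ℝ, B.rank ≤ k →
        (∑ i ∈ Finset.univ.filter (fun i : Fin m => k ≤ (i : ℕ)), (σ i) ^ 2) ≤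
          frobNormSq (X - B) := by
  have hV' : V * Vᵀ = 1 := mul_eq_one_comm.1 hV
  let u : Fin m → Fin n → ℝ := fun i a => U a (Fin.castLE hnm i)
  have hu : Orthonormal ℝ fun i => WithLp.toLp 2 (u i) :=
    (orthonormal_col hU).comp _ (Fin.castLE_injective hnm)
  have hsplit (f : Fin m → ℝ) :
      ∑ i ∈ Finset.univ.filter (fun i : Fin m => (i : ℕ) < k), f i +
        ∑ i ∈ Finset.univ.filter (fun i : Fin m => k ≤ (i : ℕ)), f i = ∑ i, f i := by
    simpa only [not_lt] using
      Finset.sum_filter_add_sum_filter_not Finset.univ (fun i : Fin m => (i : ℕ) < k) f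
  constructor
  · have hsub : X - Xk = ∑ i ∈ Finset.univ.filter (fun i : Fin m => k ≤ (i : ℕ)),
        σ i • vecMulVec (u i) (fun b => V b i) := by
      rw [hX, hXk, sub_eq_iff_eq_add', ← Finset.sum_filter_add_sum_filter_not Finset.univ
        (fun i : Fin m => (i : ℕ) < k)]
      simp only [not_lt, u]
    rw [Finset.sum_filter, ← frobNormSq_mul_of_mul_transpose_eq_one _ hV', hsub,
      frobNormSq_eq_sum_norm_col]
    refine Finset.sum_congr rfl fun j _ => ?_
    rw [sum_smul_vecMulVec_mul_col _ _ _ hV]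
    by_cases hj : k ≤ (j : ℕ)
    · simp [hj, norm_smul, hu.1 j]
    · simp [hj]
  · intro B hB
    let W := LinearMap.range (Matrix.toLpLin 2 2 B)
    let p : Fin m → ℝ := fun j => ‖W.starProjection (WithLp.toLp 2 (u j))‖ ^ 2
    have hW : Module.finrank ℝ W ≤ k := by
      rwa [B.rank_eq_finrank_range_toLin (PiLp.basisFun 2 ℝ (Fin n)) (PiLp.basisFun 2 ℝ (Fin m)),
        ← Matrix.toLpLin_eq_toLin] at hB
    have hp : ∑ j, p j ≤ k :=
      (sum_norm_starProjection_sq_le_finrank W hu).trans (by exact_mod_cast hW)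
    have hp1 (j : Fin m) : p j ≤ 1 := by
      have := W.norm_starProjection_apply_le (WithLp.toLp 2 (u j))
      rw [hu.1 j] at this
      exact pow_le_one₀ (norm_nonneg _) this
    have hkey := sum_mul_le_sum_filter_lt hk (fun i => σ i ^ 2) p (fun i => sq_nonneg _)
      (fun i j hij => pow_le_pow_left₀ (hσ0 j) (hσmono i j hij) 2) (fun j => sq_nonneg _) hp1 hp
    have hle : ∑ j, σ j ^ 2 * (1 - p j) ≤ frobNormSq (X - B) := by
      rw [← frobNormSq_mul_of_mul_transpose_eq_one _ hV', frobNormSq_eq_sum_norm_col]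
      refine Finset.sum_le_sum fun j _ => ?_
      have hcol : WithLp.toLp 2 (((X - B) * V).col j) =
          σ j • WithLp.toLp 2 (u j) - Matrix.toLpLin 2 2 B (WithLp.toLp 2 (V.col j)) := by
        have h := sum_smul_vecMulVec_mul_col Finset.univ σ u hV j
        rw [← hX, if_pos (Finset.mem_univ j)] at h
        rw [Matrix.toLpLin_toLp, ← WithLp.toLp_smul, ← WithLp.toLp_sub, ← h, Matrix.sub_mul]
        rfl
      rw [hcol]
      exact sq_mul_one_sub_le_norm_smul_sub_sq W (hu.1 j) (LinearMap.mem_range_self _ _) _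
    simp only [mul_sub, mul_one, Finset.sum_sub_distrib] at hle
    linarith [hsplit fun i => σ i ^ 2]
end
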